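/- For each n, let 𝒢_n be the family of associative trees on n variables having at least one leaf among the children of the root, such that no variable occurs together with its negation among the labels of these depth-one leaves and strictly fewer than n^{1/4} distinct literals occur among these labels. Then the limiting ratio of this family satisfies μ_n(𝒢_n) = O(1/√n) as n → ∞. -/

import Mathlib

/-- An and/or tree skeleton: leaves carry a variable index and a polarity
(`true` = positive literal, `false` = negated literal); internal nodes carry
a connective (`true` = AND, `false` = OR) and a list of children. -/
inductive AT (n : ℕ) : Type
  | leaf : Fin n → Bool → AT n
  | node : Bool → List (AT n) → AT n

namespace AT

/-- The connective at the root, if the root is an internal node. -/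
def rootConn {n : ℕ} : AT n → Option Bool
  | .leaf _ _ => none
  | .node c _ => some c

/-- Whether a tree is a single leaf. -/
def isLeafB {n : ℕ} : AT n → Bool
  | .leaf _ _ => true
  | .node _ _ => false

/-- The children of the root. -/
def rootChildren {n : ℕ} : AT n → List (AT n)
  | .leaf _ _ => []
  | .node _ ts => ts

/-- Well-formedness: an associative tree is a plane tree in which each internal
node has at least two children, no internal node has the same connective as its
parent (stratification), and leaves carry literals. -/
inductive WF {n : ℕ} : AT n → Prop
  | leaf (i : Fin n) (b : Bool) : WF (.leaf i b)
  | node (c : Bool) (ts : List (AT n)) :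
      2 ≤ ts.length → (∀ t ∈ ts, WF t) → (∀ t ∈ ts, rootConn t ≠ some c) →
      WF (.node c ts)

mutual
/-- The size of a tree: its total number of nodes. -/
def size {n : ℕ} : AT n → ℕ
  | .leaf _ _ => 1
  | .node _ ts => 1 + sizeList ts
def sizeList {n : ℕ} : List (AT n) → ℕ
  | [] => 0
  | t :: ts => size t + sizeList ts
end

mutual
/-- The Boolean function computed by a tree. -/
def eval {n : ℕ} : AT n → (Fin n → Bool) → Bool
  | .leaf i b, x => if b then x i else ! x i
  | .node c ts, x => evalList c ts x
def evalList {n : ℕ} : Bool → List (AT n) → (Fin n → Bool) → Bool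
  | c, [], _ => c
  | c, t :: ts, x => if c then eval t x && evalList c ts x
                     else eval t x || evalList c ts x
end

end AT

open AT

/-- Number of associative trees of size `m` in a family `𝒯`. -/
noncomputable def countIn (n : ℕ) (𝒯 : Set (AT n)) (m : ℕ) : ℕ :=
  Nat.card {t : AT n // t ∈ 𝒯 ∧ WF t ∧ size t = m}

/-- `A n m` is the number of associative trees of size `m` on `n` variables. -/
noncomputable def A (n m : ℕ) : ℕ := countIn n Set.univ m

/-- `Pmn n m f` is the proportion, among associative trees of size `m` on `n`
variables, of those computing the Boolean function `f`. -/
noncomputable def Pmn (n m : ℕ) (f : (Fin n → Bool) → Bool) : ℝ :=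
  (countIn n {t | eval t = f} m : ℝ) / (A n m : ℝ)

/-- Ratio of trees of size `m` in the family `𝒯` among all trees of size `m`. -/
noncomputable def ratio (n : ℕ) (𝒯 : Set (AT n)) (m : ℕ) : ℝ :=
  (countIn n 𝒯 m : ℝ) / (A n m : ℝ)

/-- `HasLimRatio n 𝒯 μ` : the limiting ratio of the family `𝒯` exists and is `μ`. -/
def HasLimRatio (n : ℕ) (𝒯 : Set (AT n)) (μ : ℝ) : Prop :=
  Filter.Tendsto (ratio n 𝒯) Filter.atTop (nhds μ)

/-- Extension of a Boolean function of `n₀` variables to `n ≥ n₀` variables. -/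
def extend {n₀ n : ℕ} (h : n₀ ≤ n) (f : (Fin n₀ → Bool) → Bool) :
    (Fin n → Bool) → Bool :=
  fun x => f (fun j => x (Fin.castLE h j))

open Classical in
/-- The tree size complexity of a Boolean function. -/
noncomputable def Lcomp (n : ℕ) (f : (Fin n → Bool) → Bool) : ℕ :=
  if f = (fun _ => true) ∨ f = (fun _ => false) then 0
  else if ∃ i : Fin n, f = (fun x => x i) ∨ f = (fun x => ! x i) then 2
  else sInf {m | ∃ t : AT n, WF t ∧ size t = m ∧ eval t = f}

/-- The labels of the leaves among the children of the root. -/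
def leafChildLabels {n : ℕ} (t : AT n) : List (Fin n × Bool) :=
  (rootChildren t).filterMap (fun s => match s with
    | .leaf i b => some (i, b)
    | .node _ _ => none)

/-- The family `𝒢_n` of associative trees having at least one leaf among the
children of the root, with no variable occurring together with its negation among
the depth-one leaf labels, and strictly fewer than `n^{1/4}` distinct literals
occurring among these labels. -/
def Gfam (n : ℕ) : Set (AT n) :=
  {t | leafChildLabels t ≠ [] ∧
    (∀ l ∈ (leafChildLabels t).toFinset, (l.1, !l.2) ∉ (leafChildLabels t).toFinset) ∧
    ((leafChildLabels t).toFinset.card : ℝ) < (n : ℝ) ^ ((1 : ℝ) / 4)}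

section Analysis
open Filter Topology PowerSeries

/-- The reference weight `(m+1)^{3/2}`. -/
noncomputable def wt (m : ℕ) : ℝ := ((m : ℝ) + 1) * Real.sqrt ((m : ℝ) + 1)

lemma wt_pos (m : ℕ) : 0 < wt m := by unfold wt; positivity

lemma wt_summable : Summable fun m : ℕ => (wt m)⁻¹ := by
  have h : Summable fun m : ℕ => 1 / ((m : ℝ)) ^ ((3:ℝ)/2) :=
    Real.summable_one_div_nat_rpow.2 (by norm_num)
  have h2 := (summable_nat_add_iff 1).2 h
  refine h2.congr fun m => ?_
  unfold wt
  have hp : (0:ℝ) < (m:ℝ) + 1 := by positivity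
  rw [Real.sqrt_eq_rpow, show (3:ℝ)/2 = 1 + 1/2 by norm_num, one_div]
  push_cast
  rw [Real.rpow_add hp, Real.rpow_one]

lemma wt_le (m k : ℕ) (h : 2 * k ≤ m) : wt m ≤ 4 * wt (m - k) := by
  unfold wt
  have hk : k ≤ m := by omega
  rw [Nat.cast_sub hk]
  have h' : (2:ℝ) * k ≤ m := by exact_mod_cast h
  have h0 : (0:ℝ) ≤ k := by positivity
  have h1 : (m:ℝ) + 1 ≤ 2 * ((m:ℝ) - k + 1) := by linarith
  have h2 : Real.sqrt ((m:ℝ) + 1) ≤ 2 * Real.sqrt ((m:ℝ) - k + 1) := by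
    rw [show (2:ℝ) * Real.sqrt ((m:ℝ) - k + 1) = Real.sqrt (4 * ((m:ℝ) - k + 1)) by
      rw [Real.sqrt_mul (by norm_num), show (4:ℝ) = 2^2 by norm_num, Real.sqrt_sq (by norm_num)]]
    apply Real.sqrt_le_sqrt
    linarith
  calc _ ≤ (2 * ((m:ℝ) - k + 1)) * (2 * Real.sqrt ((m:ℝ) - k + 1)) :=
        mul_le_mul h1 h2 (by positivity) (by linarith)
    _ = _ := by ring

lemma wt_le_sq (m : ℕ) : wt m ≤ ((m:ℝ) + 1) ^ 2 := by
  unfold wt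
  rw [sq]
  apply mul_le_mul_of_nonneg_left _ (by positivity)
  rw [Real.sqrt_le_left (by positivity)]
  have : (0:ℝ) ≤ m := by positivity
  nlinarith

lemma wt_ratio_one : Tendsto (fun m : ℕ => wt (m + 1) / wt m) atTop (𝓝 1) := by
  have h1 : Tendsto (fun m : ℕ => ((m:ℝ) + 1 + 1) / ((m:ℝ) + 1)) atTop (𝓝 1) := by
    have := tendsto_one_div_add_atTop_nhds_zero_nat (𝕜 := ℝ)
    have h := this.const_add 1
    simp only [add_zero] at h
    refine h.congr fun m => ?_
    have : (m:ℝ) + 1 ≠ 0 := by positivity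
    field_simp
  have h2 := (Real.continuous_sqrt.tendsto 1).comp h1
  have h3 := h1.mul h2
  simp only [Real.sqrt_one, mul_one] at h3
  refine h3.congr fun m => ?_
  unfold wt
  simp only [Function.comp]
  rw [Real.sqrt_div (by positivity)]
  push_cast
  rw [div_mul_div_comm]

lemma wt_ratio (k : ℕ) : Tendsto (fun m : ℕ => wt (m + k) / wt m) atTop (𝓝 1) := by
  induction k with
  | zero => simp [fun m => div_self (wt_pos m).ne']
  | succ k ih =>
    have h := (wt_ratio_one.comp (tendsto_add_atTop_nat k)).mul ih
    rw [mul_one] at h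
    refine h.congr fun m => ?_
    have := (wt_pos (m + k)).ne'
    have := (wt_pos m).ne'
    simp only [Function.comp]
    rw [← add_assoc]
    field_simp

/-- Coefficients behave like `d * (m+1)^{-3/2}`. -/
def Tame (f : PowerSeries ℝ) (d : ℝ) : Prop :=
  Tendsto (fun m => coeff m f * wt m) atTop (𝓝 d)

/-- Value at one. -/
noncomputable def ev (f : PowerSeries ℝ) : ℝ := ∑' m, coeff m f

lemma Tame.bdd {f : PowerSeries ℝ} {d : ℝ} (h : Tame f d) :
    ∃ K, 0 ≤ K ∧ ∀ m, |coeff m f| * wt m ≤ K := by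
  obtain ⟨K, hK⟩ := h.abs.bddAbove_range
  refine ⟨K, ?_, ?_⟩
  · exact le_trans (abs_nonneg _) (hK ⟨0, rfl⟩)
  · intro m
    have := hK ⟨m, rfl⟩
    simpa [abs_mul, abs_of_pos (wt_pos m)] using this

lemma Tame.summable {f : PowerSeries ℝ} {d : ℝ} (h : Tame f d) :
    Summable fun m => ‖coeff m f‖ := by
  obtain ⟨K, hK, hb⟩ := h.bdd
  refine Summable.of_nonneg_of_le (fun _ => norm_nonneg _) (fun m => ?_) (wt_summable.mul_left K)
  rw [← div_eq_mul_inv, le_div_iff₀ (wt_pos m)]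
  exact hb m

lemma Tame.hasSum {f : PowerSeries ℝ} {d : ℝ} (h : Tame f d) :
    HasSum (fun m => coeff m f) (ev f) := h.summable.of_norm.hasSum

lemma Tame.add {f g : PowerSeries ℝ} {d e : ℝ} (hf : Tame f d) (hg : Tame g e) :
    Tame (f + g) (d + e) := by
  refine (Tendsto.add hf hg).congr fun m => ?_
  simp [add_mul]

lemma Tame.ev_add {f g : PowerSeries ℝ} {d e : ℝ} (hf : Tame f d) (hg : Tame g e) :
    ev (f + g) = ev f + ev g := by
  unfold ev
  rw [← hf.summable.of_norm.tsum_add hg.summable.of_norm]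
  simp

lemma Tame.ev_mul {f g : PowerSeries ℝ} {d e : ℝ} (hf : Tame f d) (hg : Tame g e) :
    ev (f * g) = ev f * ev g := by
  unfold ev
  rw [tsum_mul_tsum_eq_tsum_sum_antidiagonal_of_summable_norm hf.summable hg.summable]
  simp [coeff_mul]

lemma tame_half {f g : PowerSeries ℝ} {d e : ℝ} (hf : Tame f d) (hg : Tame g e)
    (P : ℕ → ℕ → Prop) [∀ m k, Decidable (P m k)] (hP : ∀ m k, P m k → 2 * k ≤ m)
    (hP2 : ∀ m k, 2 * k < m → P m k) :
    Tendsto (fun m => ∑' k, if P m k then coeff k f * coeff (m - k) g * wt m else 0) atTop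
      (𝓝 (ev f * e)) := by
  obtain ⟨K, hK, hb⟩ := hg.bdd
  unfold ev
  rw [← tsum_mul_right]
  refine tendsto_tsum_of_dominated_convergence (bound := fun k => ‖coeff k f‖ * (4 * K))
    (hf.summable.mul_right _) ?_ ?_
  · intro k
    have h1 : Tendsto (fun m => coeff k f * ((coeff m g * wt m) * (wt (m + k) / wt m))) atTop
        (𝓝 (coeff k f * (e * 1))) := (Tendsto.mul hg (wt_ratio k)).const_mul _
    rw [mul_one] at h1
    rw [← tendsto_add_atTop_iff_nat k]
    refine h1.congr' ?_
    filter_upwards [eventually_gt_atTop k] with m hm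
    rw [if_pos (hP2 _ _ (by omega))]
    have := (wt_pos m).ne'
    simp only [Nat.add_sub_cancel]
    field_simp
  · refine Eventually.of_forall fun m k => ?_
    split_ifs with h
    · rw [mul_assoc, norm_mul]
      refine mul_le_mul_of_nonneg_left ?_ (norm_nonneg _)
      rw [norm_mul, Real.norm_of_nonneg (wt_pos m).le]
      calc _ ≤ ‖coeff (m - k) g‖ * (4 * wt (m - k)) :=
            mul_le_mul_of_nonneg_left (wt_le m k (hP _ _ h)) (norm_nonneg _)
        _ = 4 * (|coeff (m - k) g| * wt (m - k)) := by rw [Real.norm_eq_abs]; ring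
        _ ≤ _ := by linarith [hb (m - k)]
    · simp only [norm_zero]; positivity

lemma Tame.mul {f g : PowerSeries ℝ} {d e : ℝ} (hf : Tame f d) (hg : Tame g e) :
    Tame (f * g) (ev f * e + ev g * d) := by
  have h1 := tame_half hf hg (fun m k => 2 * k ≤ m) (fun _ _ h => h) (fun _ _ h => h.le)
  have h2 := tame_half hg hf (fun m k => 2 * k < m) (fun _ _ h => h.le) (fun _ _ h => h)
  refine (h1.add h2).congr fun m => ?_
  have e1 : ∀ (P : ℕ → Prop) [DecidablePred P] (F : ℕ → ℝ), (∀ k, P k → k ≤ m) →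
      (∑' k, if P k then F k else 0) = ∑ k ∈ Finset.range (m+1), if P k then F k else 0 := by
    intro P _ F hP
    apply tsum_eq_sum
    intro k hk
    rw [if_neg]
    intro h
    exact hk (Finset.mem_range.2 (by have := hP k h; omega))
  rw [e1 _ _ (fun k hk => by omega), e1 _ _ (fun k hk => by omega)]
  rw [← Finset.sum_range_reflect (fun k => if 2 * k < m then coeff k g * coeff (m - k) f * wt m else 0),
    ← Finset.sum_add_distrib, coeff_mul,
    Finset.Nat.sum_antidiagonal_eq_sum_range_succ (fun i j => coeff i f * coeff j g),
    Finset.sum_mul]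
  refine Finset.sum_congr rfl fun k hk => ?_
  have hk' := Finset.mem_range.1 hk
  have e2 : m + 1 - 1 - k = m - k := by omega
  have e3 : m - (m - k) = k := by omega
  rw [e2, e3]
  by_cases h : 2 * k ≤ m
  · rw [if_pos h, if_neg (by omega), add_zero]
  · rw [if_neg h, if_pos (by omega), zero_add]; ring

lemma tame_of_zero {f : PowerSeries ℝ} (N : ℕ) (h : ∀ m, N ≤ m → coeff m f = 0) : Tame f 0 := by
  refine tendsto_const_nhds.congr' ?_
  filter_upwards [eventually_ge_atTop N] with m hm
  rw [h m hm, zero_mul]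

lemma tame_C (a : ℝ) : Tame (C a) 0 :=
  tame_of_zero 1 fun m hm => by rw [coeff_C, if_neg (by omega)]

lemma tame_X : Tame X 0 :=
  tame_of_zero 2 fun m hm => by rw [coeff_X, if_neg (by omega)]

lemma ev_C (a : ℝ) : ev (C a) = a := by
  unfold ev
  rw [tsum_eq_single 0]
  · simp
  · intro m hm; simp [coeff_C, hm]

lemma ev_X : ev X = 1 := by
  unfold ev
  rw [tsum_eq_single 1]
  · simp
  · intro m hm; simp [coeff_X, hm]

lemma Tame.smul {f : PowerSeries ℝ} {d : ℝ} (hf : Tame f d) (a : ℝ) : Tame (C a * f) (a * d) := by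
  simpa [ev_C] using (tame_C a).mul hf

lemma Tame.ev_smul {f : PowerSeries ℝ} {d : ℝ} (hf : Tame f d) (a : ℝ) :
    ev (C a * f) = a * ev f := by
  rw [(tame_C a).ev_mul hf, ev_C]

lemma Tame.pow {f : PowerSeries ℝ} {d : ℝ} (hf : Tame f d) (j : ℕ) :
    Tame (f ^ j) (j * ev f ^ (j - 1) * d) ∧ ev (f ^ j) = ev f ^ j := by
  induction j with
  | zero =>
    have h1 := tame_C 1
    have h2 := ev_C 1
    simp only [map_one] at h1 h2
    simpa using ⟨h1, h2⟩
  | succ j ih =>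
    constructor
    · have := ih.1.mul hf
      rw [pow_succ]
      convert this using 1
      rw [ih.2]
      cases j with
      | zero => simp
      | succ j => simp only [Nat.add_sub_cancel]; push_cast; ring
    · rw [pow_succ, ih.1.ev_mul hf, ih.2, pow_succ]

/-- The scaled Catalan series. -/
noncomputable def catS : PowerSeries ℝ := PowerSeries.mk fun m => (catalan m : ℝ) / 4 ^ m

lemma catS_eq : catS = 1 + C (1/4) * (X * catS ^ 2) := by
  have h := congrArg (PowerSeries.map (Nat.castRingHom ℝ)) catalanSeries_sq_mul_X_add_one
  have h2 := congrArg (rescale (1/4 : ℝ)) h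
  have h3 : rescale (1/4 : ℝ) (PowerSeries.map (Nat.castRingHom ℝ) catalanSeries) = catS := by
    ext m
    simp [catS, coeff_rescale, div_eq_inv_mul]
  simp only [map_add, map_mul, map_pow, map_one, map_X, rescale_X, h3] at h2
  rw [← h2.symm.symm]
  rw [h2]
  nth_rewrite 1 [← h2]
  ring

lemma catS_tame : ∃ d, d ≠ 0 ∧ Tame catS d := by
  have hW := Real.Wallis.tendsto_W_nhds_pi_div_two
  have h1 : Tendsto (fun m : ℕ => ((m:ℝ) + 1) / (2 * m + 1)) atTop (𝓝 (1/2)) := by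
    have := Stirling.tendsto_self_div_two_mul_self_add_one
    have h0 : Tendsto (fun m : ℕ => (1:ℝ) / (2 * m + 1)) atTop (𝓝 0) := by
      have := (tendsto_one_div_add_atTop_nhds_zero_nat (𝕜 := ℝ))
      refine squeeze_zero (fun m => by positivity) (fun m => ?_) this
      apply one_div_le_one_div_of_le (by positivity)
      have : (0:ℝ) ≤ m := by positivity
      linarith
    have h := this.add h0
    rw [add_zero] at h
    refine h.congr fun m => ?_
    rw [← add_div]
  have h2 := (Real.continuous_sqrt.tendsto _).comp (h1.div hW (by positivity))
  refine ⟨_, ?_, h2.congr fun m => ?_⟩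
  · apply ne_of_gt; positivity
  · have hc : (catalan m : ℝ) * ((m:ℝ) + 1) = (m.centralBinom : ℝ) := by
      have := succ_mul_catalan_eq_centralBinom m
      rw [← this]; push_cast; ring
    have hcb : (m.centralBinom : ℝ) = ((2*m).factorial : ℝ) / ((m.factorial:ℝ)^2) := by
      rw [eq_div_iff (by positivity)]
      have := Nat.choose_mul_factorial_mul_factorial (n := 2 * m) (k := m) (by omega)
      rw [show 2 * m - m = m by omega] at this
      rw [Nat.centralBinom_eq_two_mul_choose, ← this]; push_cast; ring
    have hcoef : coeff m catS * wt m = (m.centralBinom : ℝ) / 4 ^ m * Real.sqrt ((m:ℝ) + 1) := by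
      simp only [catS, coeff_mk, wt]
      rw [← hc]; ring
    rw [hcoef]
    simp only [Function.comp, Pi.div_apply]
    rw [Real.sqrt_eq_iff_mul_self_eq (by have := Real.Wallis.W_pos m; positivity) (by positivity)]
    rw [show ∀ a b : ℝ, (a * b) * (a * b) = a * a * (b * b) by intros; ring,
      Real.mul_self_sqrt (by positivity), Real.Wallis.W_eq_factorial_ratio, hcb]
    have e4 : (2:ℝ) ^ (4 * m) = (4 ^ m) ^ 2 := by
      rw [← pow_mul, pow_mul, mul_comm m 2, pow_mul]; norm_num
    rw [e4]
    have : ((2*m).factorial : ℝ) ≠ 0 := by positivity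
    have : (m.factorial : ℝ) ≠ 0 := by positivity
    field_simp

/-- The series of `√(1 - X)`. -/
noncomputable def sq1 : PowerSeries ℝ := 1 - C (1/2) * (X * catS)

lemma sq1_sq : sq1 ^ 2 = 1 - X := by
  have h := catS_eq
  have hC : (C (1/2 : ℝ)) ^ 2 = C (1/4 : ℝ) := by rw [← map_pow]; norm_num
  have hC2 : (2 : PowerSeries ℝ) * C (1/2 : ℝ) = 1 := by
    rw [show (2 : PowerSeries ℝ) = C 2 from (map_ofNat C 2).symm, ← map_mul]; norm_num
  unfold sq1
  linear_combination X * hC2 * (-catS) + X ^ 2 * catS ^ 2 * hC - X * h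

lemma sq1_tame : ∃ d, d ≠ 0 ∧ Tame sq1 d := by
  obtain ⟨d, hd, h⟩ := catS_tame
  refine ⟨-(1/2) * d, by simpa using hd, ?_⟩
  have := (tame_C 1).add ((tame_X.mul h).smul (-(1/2)))
  convert this using 1
  · unfold sq1
    rw [map_neg, map_one]; ring
  · rw [ev_X]; ring

lemma ev_one_sub (a : ℝ) : ev (1 - C a * X) = 1 - a := by
  have h := (tame_C 1).ev_add (tame_X.smul (-a))
  rw [tame_X.ev_smul, ev_C, ev_X] at h
  rw [show (1 : PowerSeries ℝ) - C a * X = C 1 + C (-a) * X by rw [map_neg, map_one]; ring, h]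
  ring

lemma ev_sq1 : ev sq1 = 0 := by
  obtain ⟨d, hd, h⟩ := sq1_tame
  have h1 := (h.pow 2).2
  have h2 := ev_one_sub 1
  rw [sq1_sq] at h1
  simp only [map_one, one_mul, sub_self] at h2
  rw [h2] at h1
  exact pow_eq_zero_iff (two_ne_zero) |>.1 h1.symm

lemma Tame.rescale {f : PowerSeries ℝ} {d : ℝ} (h : Tame f d) {a : ℝ} (ha : |a| < 1) :
    Tame (rescale a f) 0 := by
  have := (tendsto_pow_atTop_nhds_zero_of_abs_lt_one ha).mul h
  rw [zero_mul] at this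
  refine this.congr fun m => ?_
  simp [coeff_rescale]; ring

/-- Geometric series. -/
lemma tame_geom {a : ℝ} (ha : |a| < 1) : Tame (PowerSeries.mk fun m => a ^ m) 0 := by
  have h1 : Tendsto (fun m : ℕ => |a| ^ m * ((m:ℝ) + 1)^2) atTop (𝓝 0) := by
    have hb : |(|a|)| < 1 := by rwa [abs_abs]
    have e2 := tendsto_pow_const_mul_const_pow_of_abs_lt_one 2 hb
    have e1 := tendsto_pow_const_mul_const_pow_of_abs_lt_one 1 hb
    have e0 := tendsto_pow_const_mul_const_pow_of_abs_lt_one 0 hb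
    have := (e2.add (e1.const_mul 2)).add e0
    simp only [mul_zero, add_zero] at this
    refine this.congr fun m => ?_
    ring
  rw [Tame, tendsto_zero_iff_norm_tendsto_zero]
  refine squeeze_zero (fun _ => norm_nonneg _) (fun m => ?_) h1
  rw [coeff_mk, norm_mul, norm_pow, Real.norm_eq_abs, Real.norm_of_nonneg (wt_pos m).le]
  exact mul_le_mul_of_nonneg_left (wt_le_sq m) (by positivity)

lemma geom_mul (a : ℝ) : (PowerSeries.mk fun m => a ^ m) * (1 - C a * X) = 1 := by
  ext m
  rw [mul_sub, mul_one, map_sub, coeff_mk, mul_left_comm, coeff_C_mul]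
  cases m with
  | zero => simp
  | succ m => rw [coeff_succ_mul_X, coeff_mk, coeff_one, if_neg (by omega)]; ring

/-- The dominant singularity. -/
noncomputable def rho (n : ℕ) : ℝ := 1 / (2 * ((n:ℝ) + Real.sqrt (2 * n)))

lemma rho_pos {n : ℕ} (hn : 1 ≤ n) : 0 < rho n := by
  unfold rho
  have : (0:ℝ) < n := by exact_mod_cast hn
  positivity

lemma rho_eq {n : ℕ} (hn : 1 ≤ n) : 1 - 4 * n * rho n + (4 * n ^ 2 - 8 * n) * rho n ^ 2 = 0 := by
  unfold rho
  have h0 : (0:ℝ) < n := by exact_mod_cast hn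
  have hs : Real.sqrt (2 * n) ^ 2 = 2 * n := Real.sq_sqrt (by positivity)
  have : (n:ℝ) + Real.sqrt (2 * n) ≠ 0 := by positivity
  generalize Real.sqrt (2 * n) = s at *
  field_simp
  linear_combination 4 * hs

lemma two_n_rho {n : ℕ} (hn : 1 ≤ n) : 2 * n * rho n < 1 := by
  unfold rho
  have h0 : (0:ℝ) < n := by exact_mod_cast hn
  have hs : 0 < Real.sqrt (2 * n) := by positivity
  rw [mul_one_div, div_lt_one (by positivity)]
  linarith

lemma five_n_rho {n : ℕ} (hn : 1 ≤ n) : 1 ≤ 5 * n * rho n := by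
  unfold rho
  have h0 : (1:ℝ) ≤ n := by exact_mod_cast hn
  have hs : Real.sqrt (2 * n) ≤ 3 / 2 * n := by
    rw [Real.sqrt_le_left (by positivity)]; nlinarith
  rw [mul_one_div, one_le_div (by positivity)]
  linarith

lemma main_analytic {n : ℕ} (hn : 1 ≤ n) (N : PowerSeries ℝ) (h0 : constantCoeff N = 0)
    (hN : N * (1 - (C (2 * n : ℝ) * X + N)) = X * (C (2 * n : ℝ) * X + N) ^ 2) :
    ∃ d, d ≠ 0 ∧ Tame (rescale (rho n) N) d ∧
      2 * n * rho n + ev (rescale (rho n) N) < 1 ∧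
      rho n = (1 + rho n) * (1 - (2 * n * rho n + ev (rescale (rho n) N))) ^ 2 := by
  set r := rho n with hr
  have hrpos : 0 < r := rho_pos hn
  have hr1 : r < 1 := by
    have := two_n_rho hn
    have : (1:ℝ) ≤ n := by exact_mod_cast hn
    nlinarith
  have hreq := rho_eq hn
  rw [← hr] at hreq
  set M := rescale r N with hM
  set T := C (2 * n * r) * X + M with hT
  have hCa : C (2 * n * r) = C (2 * n : ℝ) * C r := map_mul _ _ _
  have hTeq : (1 + C r * X) * T ^ 2 - (1 + C (2 * n * r) * X) * T + C (2 * n * r) * X = 0 := by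
    have hrc : rescale r (C (2 * n : ℝ)) = C (2 * n : ℝ) := by
      ext m
      rw [coeff_rescale, coeff_C]
      split_ifs with hm <;> simp [hm]
    have h := congrArg (rescale r) hN
    clear_value T
    generalize C (2 * n : ℝ) = c at *
    simp only [map_mul, map_sub, map_add, map_pow, map_one, rescale_X, hrc] at h
    rw [← hM] at h
    have hM' : M = T - c * (C r * X) := by rw [hT, hCa]; ring
    simp only [hM'] at h
    rw [hCa]
    linear_combination -h
  set g : ℝ := 4 * n * r - 1 with hg
  have hg1 : |g| < 1 := by
    have h2 := two_n_rho hn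
    have h3 : (0:ℝ) < n := by exact_mod_cast hn
    rw [abs_lt]
    constructor <;> rw [hg]
    · have : 0 < n * r := by positivity
      linarith
    · rw [← hr] at h2; linarith
  obtain ⟨d, hd, hs⟩ := sq1_tame
  set S := rescale g sq1 with hS
  have hSt : Tame S 0 := hs.rescale hg1
  have hS2 : S ^ 2 = 1 - C g * X := by
    rw [hS, ← map_pow, sq1_sq]; simp [rescale_X]
  have hevS : ev S ≠ 0 := by
    have h1 := (hSt.pow 2).2
    rw [hS2, ev_one_sub] at h1
    intro h
    rw [h] at h1
    have := (abs_lt.1 hg1).2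
    norm_num at h1
    linarith
  have hsq : (C 2 * (1 + C r * X) * T - (1 + C (2 * n * r) * X)) ^ 2 = (sq1 * S) ^ 2 := by
    rw [mul_pow, hS2, sq1_sq]
    have e1 : C g = C (2:ℝ) * C (2 * n * r) - 1 := by
      rw [← map_mul, ← map_one C, ← map_sub]; congr 1; rw [hg]; ring
    have e2 : C (2 * n * r) ^ 2 - 4 * C (2 * n * r) * C r = C g := by
      rw [← map_pow, show (4 : PowerSeries ℝ) = C 4 from (map_ofNat C 4).symm, ← map_mul,
        ← map_mul, ← map_sub]
      congr 1; rw [hg]; linear_combination hreq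
    have e3 : C (2:ℝ) = 2 := map_ofNat C 2
    rw [e3] at e1 ⊢
    linear_combination 4 * (1 + C r * X) * hTeq + X ^ 2 * e2 + X * e1
  have hc1 : constantCoeff sq1 = 1 := by
    simp [sq1]
  have hcS : constantCoeff S = 1 := by
    rw [hS, ← coeff_zero_eq_constantCoeff_apply, coeff_rescale, coeff_zero_eq_constantCoeff_apply,
      hc1]
    simp
  have hcM : constantCoeff M = 0 := by
    rw [hM, ← coeff_zero_eq_constantCoeff_apply, coeff_rescale, coeff_zero_eq_constantCoeff_apply,
      h0]
    simp
  have hlin : C 2 * (1 + C r * X) * T = (1 + C (2 * n * r) * X) - sq1 * S := by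
    rcases sq_eq_sq_iff_eq_or_eq_neg.1 hsq with h | h
    · exfalso
      have := congrArg (constantCoeff (R := ℝ)) h
      simp [hT, hcM, hc1, hcS] at this
      norm_num at this
    · linear_combination h
  set G : PowerSeries ℝ := PowerSeries.mk fun m => (-r) ^ m with hG
  have hr2 : |-r| < 1 := by rw [abs_neg, abs_of_pos hrpos]; exact hr1
  have hGt : Tame G 0 := tame_geom hr2
  have hGm : G * (1 + C r * X) = 1 := by
    have := geom_mul (-r)
    rwa [map_neg, neg_mul, sub_neg_eq_add] at this
  have hCh : C (1/2 : ℝ) * C 2 = 1 := by rw [← map_mul]; norm_num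
  have hTT : T = C (1/2) * (G * ((C 1 + C (2 * n * r) * X) + C (-1) * (sq1 * S))) := by
    rw [map_neg, map_one]
    linear_combination (-T) * hCh + (-C (1/2) * C 2 * T) * hGm + C (1/2) * G * hlin
  have t1 := hs.mul hSt
  have t2 := ((tame_C 1).add (tame_X.smul (2 * n * r))).add (t1.smul (-1))
  have t3 := (hGt.mul t2).smul (1/2)
  rw [← hTT] at t3
  have evG : ev G * (1 + r) = 1 := by
    have h1 := hGt.ev_mul ((tame_C 1).add (tame_X.smul r))
    rw [(tame_C 1).ev_add (tame_X.smul r), tame_X.ev_smul, ev_C, ev_X, mul_one, map_one, hGm] at h1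
    have := ev_C 1
    rw [map_one] at this
    rw [← h1, this]
  have evT : 2 * (1 + r) * ev T = 1 + 2 * n * r := by
    rw [hTT, (hGt.mul t2).ev_smul, hGt.ev_mul t2,
      ((tame_C 1).add (tame_X.smul (2 * n * r))).ev_add (t1.smul (-1)),
      (tame_C 1).ev_add (tame_X.smul _), t1.ev_smul, hs.ev_mul hSt, tame_X.ev_smul, ev_C, ev_X,
      ev_sq1]
    linear_combination (1 + 2 * n * r) * evG
  have hevG : ev G ≠ 0 := by
    intro h; rw [h] at evG; norm_num at evG
  have hMT : M = T + C (-(2 * n * r)) * X := by rw [hT, map_neg]; ring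
  have t4 := t3.add (tame_X.smul (-(2 * n * r)))
  rw [← hMT] at t4
  have evM : 2 * n * r + ev M = ev T := by
    rw [hMT, t3.ev_add (tame_X.smul _), tame_X.ev_smul, ev_X]; ring
  refine ⟨_, ?_, t4, ?_, ?_⟩
  · rw [ev_sq1]
    simp [hevG, hevS, hd]
  · rw [evM]
    have h2 := two_n_rho hn
    rw [← hr] at h2
    nlinarith
  · rw [evM]
    have h5 : 2 * (1 + r) * (1 - ev T) = 1 + 2 * r - 2 * n * r := by linear_combination -evT
    have h6 : (2 * (1 + r) * (1 - ev T)) ^ 2 = (1 + 2 * r - 2 * n * r) ^ 2 := by rw [h5]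
    have h7 : (4 * (1 + r)) * (r - (1 + r) * (1 - ev T) ^ 2) = 0 := by
      linear_combination -h6 - hreq
    have : (4 * (1 + r)) ≠ 0 := by positivity
    have := (mul_eq_zero.1 h7).resolve_left this
    linarith

end Analysis

section Combinatorics
open PowerSeries

/-- Generating function of a type with a size. -/
noncomputable def gf {Y : Type} (s : Y → ℕ) : PowerSeries ℝ :=
  PowerSeries.mk fun m => (Nat.card {y // s y = m} : ℝ)

/-- Finite fibres. -/
def FF {Y : Type} (s : Y → ℕ) : Prop := ∀ m, Finite {y // s y = m}

lemma gf_congr {Y Z : Type} {s : Y → ℕ} {t : Z → ℕ} (e : Y ≃ Z) (h : ∀ y, s y = t (e y)) :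
    gf s = gf t := by
  ext m
  simp only [gf, coeff_mk]
  congr 1
  exact Nat.card_congr (e.subtypeEquiv fun y => by rw [h])

lemma gf_sum {Y Z : Type} {s : Y → ℕ} {t : Z → ℕ} (hs : FF s) (ht : FF t) :
    gf (Sum.elim s t) = gf s + gf t := by
  ext m
  have := hs m
  have := ht m
  simp only [gf, coeff_mk, map_add]
  rw [← Nat.cast_add, ← Nat.card_sum]
  congr 1
  exact Nat.card_congr Equiv.subtypeSum

lemma gf_prod {Y Z : Type} {s : Y → ℕ} {t : Z → ℕ} (hs : FF s) (ht : FF t) :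
    gf (fun p : Y × Z => s p.1 + t p.2) = gf s * gf t := by
  ext m
  have := hs
  have := ht
  simp only [FF] at this hs
  rw [coeff_mul]
  simp only [gf, coeff_mk]
  let e : {p : Y × Z // s p.1 + t p.2 = m} ≃
      Σ ij : Finset.HasAntidiagonal.antidiagonal m, {y // s y = ij.1.1} × {z // t z = ij.1.2} :=
    { toFun := fun p => ⟨⟨(s p.1.1, t p.1.2), by simpa using p.2⟩, ⟨p.1.1, rfl⟩, ⟨p.1.2, rfl⟩⟩
      invFun := fun q => ⟨(q.2.1.1, q.2.2.1), by
        rw [q.2.1.2, q.2.2.2]; exact Finset.HasAntidiagonal.mem_antidiagonal.1 q.1.2⟩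
      left_inv := fun p => rfl
      right_inv := by
        rintro ⟨⟨⟨i, j⟩, h⟩, ⟨y, hy⟩, ⟨z, hz⟩⟩
        simp only at hy hz
        subst hy hz
        rfl }
  rw [Nat.card_congr e, Nat.card_sigma]
  push_cast
  rw [← Finset.sum_coe_sort (Finset.HasAntidiagonal.antidiagonal m)]
  refine Finset.sum_congr rfl fun ij _ => ?_
  rw [Nat.card_prod]; push_cast; rfl

lemma gf_succ {Y : Type} (s : Y → ℕ) : gf (fun y => s y + 1) = X * gf s := by
  ext m
  cases m with
  | zero => simp [gf]
  | succ m =>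
    rw [coeff_succ_X_mul]
    simp only [gf, coeff_mk]
    congr 1
    exact Nat.card_congr (Equiv.subtypeEquivRight fun y => by omega)

lemma FF.of_inj {Y Z : Type} {s : Y → ℕ} {t : Z → ℕ} (ht : FF t) (e : Y → Z)
    (he : Function.Injective e) (h : ∀ y, s y = t (e y)) : FF s := by
  intro m
  have := ht m
  exact Finite.of_injective (fun y : {y // s y = m} => (⟨e y.1, by rw [← h, y.2]⟩ : {z // t z = m}))
    fun a b hab => Subtype.ext (he (congrArg Subtype.val hab))

lemma mem_size_le {n : ℕ} {t : AT n} {l : List (AT n)} (h : t ∈ l) : size t ≤ sizeList l := by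
  induction l with
  | nil => simp at h
  | cons a l ih =>
    rw [sizeList]
    rcases List.mem_cons.1 h with rfl | h
    · omega
    · have := ih h; omega

lemma size_pos {n : ℕ} (t : AT n) : 1 ≤ size t := by
  cases t <;> rw [size]
  omega

lemma length_le_sizeList {n : ℕ} (l : List (AT n)) : l.length ≤ sizeList l := by
  induction l with
  | nil => simp
  | cons a l ih =>
    rw [sizeList, List.length_cons]
    have := size_pos a
    omega

lemma finite_lists {α : Type} (S : Set α) (hS : S.Finite) (m : ℕ) :
    {l : List α | l.length ≤ m ∧ ∀ x ∈ l, x ∈ S}.Finite := by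
  have := hS.to_subtype
  refine ((List.finite_length_le S m).image (List.map Subtype.val)).subset ?_
  rintro l ⟨h1, h2⟩
  lift l to List S using h2
  exact ⟨l, by simpa using h1, rfl⟩

lemma finite_size_le (n m : ℕ) : {t : AT n | size t ≤ m}.Finite := by
  induction m with
  | zero =>
    convert Set.finite_empty
    ext t
    have := size_pos t
    simp; omega
  | succ m ih =>
    have h1 := finite_lists _ ih m
    refine ((Set.finite_range fun p : Fin n × Bool => AT.leaf p.1 p.2).union
      ((h1.image (AT.node true)).union (h1.image (AT.node false)))).subset ?_
    intro t ht
    cases t with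
    | leaf i b => exact Or.inl ⟨(i, b), rfl⟩
    | node c l =>
      right
      simp only [Set.mem_ofPred_eq, size] at ht
      have hl : l ∈ {l : List (AT n) | l.length ≤ m ∧ ∀ x ∈ l, x ∈ {t : AT n | size t ≤ m}} := by
        refine ⟨?_, fun x hx => ?_⟩
        · have := length_le_sizeList l; omega
        · have := mem_size_le hx
          simp only [Set.mem_ofPred_eq]; omega
      cases c
      · right; exact ⟨l, hl, rfl⟩
      · left; exact ⟨l, hl, rfl⟩

lemma FF_size (n : ℕ) : FF (size (n := n)) := fun m =>
  ((finite_size_le n m).subset (fun t (ht : size t = m) => ht.le)).to_subtype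

lemma FF_sizeList (n : ℕ) : FF (sizeList (n := n)) := fun m =>
  ((finite_lists _ (finite_size_le n m) m).subset (fun l (hl : sizeList l = m) =>
    ⟨by have := length_le_sizeList l; omega, fun x hx => by
      have := mem_size_le hx
      simp only [Set.mem_ofPred_eq]; omega⟩)).to_subtype

/-- Admissible children of a node labelled `c`. -/
abbrev BT (n : ℕ) (c : Bool) : Type := {t : AT n // WF t ∧ rootConn t ≠ some c}
/-- Trees whose root is labelled `c`. -/
abbrev NT (n : ℕ) (c : Bool) : Type := {t : AT n // WF t ∧ rootConn t = some c}
/-- Lists of admissible children. -/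
abbrev LT' (n : ℕ) (c : Bool) : Type := {l : List (AT n) // ∀ t ∈ l, WF t ∧ rootConn t ≠ some c}

lemma FF_BT (n : ℕ) (c : Bool) : FF (fun t : BT n c => size t.1) :=
  (FF_size n).of_inj Subtype.val Subtype.val_injective fun _ => rfl
lemma FF_NT (n : ℕ) (c : Bool) : FF (fun t : NT n c => size t.1) :=
  (FF_size n).of_inj Subtype.val Subtype.val_injective fun _ => rfl
lemma FF_LT (n : ℕ) (c : Bool) : FF (fun t : LT' n c => sizeList t.1) :=
  (FF_sizeList n).of_inj Subtype.val Subtype.val_injective fun _ => rfl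

lemma FF_lit (n : ℕ) : FF (fun _ : Fin n × Bool => 1) := fun _ => inferInstance

lemma gf_lit (n : ℕ) : gf (fun _ : Fin n × Bool => 1) = C (2 * n : ℝ) * X := by
  ext m
  rw [coeff_C_mul, coeff_X]
  simp only [gf, coeff_mk]
  split_ifs with h
  · subst h; simp; ring
  · have : IsEmpty {y : Fin n × Bool // 1 = m} := ⟨fun y => h y.2.symm⟩
    simp

lemma WF.node_iff {n : ℕ} {c : Bool} {ts : List (AT n)} : WF (.node c ts) ↔
    2 ≤ ts.length ∧ ∀ t ∈ ts, WF t ∧ rootConn t ≠ some c := by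
  constructor
  · intro h
    cases h with
    | node _ _ h1 h2 h3 => exact ⟨h1, fun t ht => ⟨h2 t ht, h3 t ht⟩⟩
  · rintro ⟨h1, h2⟩
    exact .node c ts h1 (fun t ht => (h2 t ht).1) (fun t ht => (h2 t ht).2)

/-- The node series. -/
noncomputable def NS (n : ℕ) (c : Bool) : PowerSeries ℝ := gf (fun t : NT n c => size t.1)

lemma gf_BT (n : ℕ) (c : Bool) :
    gf (fun t : BT n c => size t.1) = C (2 * n : ℝ) * X + NS n (!c) := by
  rw [← gf_lit, NS, ← gf_sum (FF_lit n) (FF_NT n _)]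
  symm
  refine gf_congr (Equiv.ofBijective (Sum.elim
    (fun p => (⟨.leaf p.1 p.2, .leaf _ _, by simp [rootConn]⟩ : BT n c))
    (fun t => ⟨t.1, t.2.1, by rw [t.2.2]; simp⟩)) ⟨?_, ?_⟩) ?_
  · rintro (⟨i, b⟩ | ⟨t, ht⟩) (⟨i', b'⟩ | ⟨t', ht'⟩) h
    · have := congrArg Subtype.val h
      simp only [Sum.elim_inl] at this
      injection this with h1 h2
      rw [h1, h2]
    · have := congrArg Subtype.val h
      simp only [Sum.elim_inl, Sum.elim_inr] at this
      subst this
      simp [rootConn] at ht'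
    · have := congrArg Subtype.val h
      simp only [Sum.elim_inl, Sum.elim_inr] at this
      subst this
      simp [rootConn] at ht
    · have := congrArg Subtype.val h
      simp only [Sum.elim_inr] at this
      subst this
      rfl
  · rintro ⟨t, h1, h2⟩
    cases t with
    | leaf i b => exact ⟨Sum.inl (i, b), rfl⟩
    | node c' ts =>
      refine ⟨Sum.inr ⟨.node c' ts, h1, ?_⟩, rfl⟩
      simp only [rootConn, ne_eq, Option.some.injEq] at h2 ⊢
      cases c <;> cases c' <;> simp_all
  · rintro (⟨i, b⟩ | ⟨t, ht⟩)
    · show 1 = size (AT.leaf i b)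
      rw [size]
    · rfl

/-- Splitting off the head. -/
def consE (n : ℕ) (c : Bool) : BT n c × LT' n c ≃ {l : LT' n c // l.1 ≠ []} where
  toFun p := ⟨⟨p.1.1 :: p.2.1, by
    intro t ht
    rcases List.mem_cons.1 ht with rfl | h
    · exact p.1.2
    · exact p.2.2 t h⟩, by simp⟩
  invFun l := match l with
    | ⟨⟨[], _⟩, h⟩ => absurd rfl h
    | ⟨⟨t :: l, h⟩, _⟩ => (⟨t, h t (by simp)⟩, ⟨l, fun s hs => h s (by simp [hs])⟩)
  left_inv p := rfl
  right_inv := by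
    rintro ⟨⟨_ | ⟨t, l⟩, h⟩, h'⟩
    · exact absurd rfl h'
    · rfl

lemma gf_LT (n : ℕ) (c : Bool) :
    gf (fun l : LT' n c => sizeList l.1) =
      1 + (C (2 * n : ℝ) * X + NS n (!c)) * gf (fun l : LT' n c => sizeList l.1) := by
  rw [← gf_BT]
  rw [← gf_prod (FF_BT n c) (FF_LT n c)]
  have h1 : (1 : PowerSeries ℝ) = gf (fun _ : Unit => 0) := by
    ext m
    simp only [gf, coeff_mk, coeff_one]
    split_ifs with h
    · subst h; simp
    · have : IsEmpty {y : Unit // 0 = m} := ⟨fun y => h y.2.symm⟩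
      simp
  have hfu : FF (fun _ : Unit => 0) := fun m => inferInstance
  have hfp : FF (fun p : BT n c × LT' n c => size p.1.1 + sizeList p.2.1) :=
    (FF_LT n c).of_inj (fun p => (consE n c p).1)
      (Subtype.val_injective.comp (consE n c).injective) (fun p => by
        simp [consE, sizeList])
  rw [h1, ← gf_sum hfu hfp]
  symm
  refine gf_congr (Equiv.ofBijective (Sum.elim
    (fun _ => (⟨[], by simp⟩ : LT' n c)) (fun p => (consE n c p).1)) ⟨?_, ?_⟩) ?_
  · rintro (u | p) (u' | p') h
    · rfl
    · exact absurd (congrArg Subtype.val h).symm (consE n c p').2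
    · exact absurd (congrArg Subtype.val h) (consE n c p).2
    · exact congrArg Sum.inr ((consE n c).injective (Subtype.ext h))
  · intro l
    by_cases h : l.1 = []
    · exact ⟨Sum.inl (), Subtype.ext h.symm⟩
    · exact ⟨Sum.inr ((consE n c).symm ⟨l, h⟩), by
        rw [Sum.elim_inr, Equiv.apply_symm_apply]⟩
  · rintro (u | p)
    · show 0 = sizeList []
      rw [sizeList]
    · show _ = sizeList (p.1.1 :: p.2.1)
      rw [sizeList]
      rfl

/-- A tree with root `c` from two children and the rest. -/
def nodeMk (n : ℕ) (c : Bool) (p : BT n c × (BT n c × LT' n c)) : NT n c :=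
  ⟨.node c (p.1.1 :: p.2.1.1 :: p.2.2.1), WF.node_iff.2 ⟨by simp, by
    intro t ht
    rcases List.mem_cons.1 ht with rfl | ht
    · exact p.1.2
    rcases List.mem_cons.1 ht with rfl | ht
    · exact p.2.1.2
    · exact p.2.2.2 t ht⟩, rfl⟩

lemma nodeMk_bij (n : ℕ) (c : Bool) : Function.Bijective (nodeMk n c) := by
  constructor
  · rintro ⟨⟨a, _⟩, ⟨b, _⟩, ⟨l, _⟩⟩ ⟨⟨a', _⟩, ⟨b', _⟩, ⟨l', _⟩⟩ h
    have := congrArg Subtype.val h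
    simp only [nodeMk, AT.node.injEq, List.cons.injEq, true_and] at this
    obtain ⟨rfl, rfl, rfl⟩ := this
    rfl
  · rintro ⟨t, h1, h2⟩
    cases t with
    | leaf i b => simp [rootConn] at h2
    | node c' ts =>
      simp only [rootConn, Option.some.injEq] at h2
      subst h2
      obtain ⟨h3, h4⟩ := WF.node_iff.1 h1
      match ts, h3, h4 with
      | a :: b :: l, _, h4 =>
        exact ⟨(⟨a, h4 a (by simp)⟩, ⟨b, h4 b (by simp)⟩, ⟨l, fun t ht => h4 t (by simp [ht])⟩), rfl⟩

lemma NS_eq (n : ℕ) (c : Bool) :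
    NS n c = X * (C (2 * n : ℝ) * X + NS n (!c)) ^ 2 * gf (fun l : LT' n c => sizeList l.1) := by
  have hf2 : FF (fun p : BT n c × LT' n c => size p.1.1 + sizeList p.2.1) :=
    (FF_LT n c).of_inj (fun p => (consE n c p).1)
      (Subtype.val_injective.comp (consE n c).injective) (fun p => by
        simp [consE, sizeList])
  have h1 := gf_prod (FF_BT n c) hf2
  rw [gf_prod (FF_BT n c) (FF_LT n c)] at h1
  rw [sq, ← gf_BT, mul_assoc, mul_assoc, ← h1, ← gf_succ, NS]
  symm
  refine gf_congr (Equiv.ofBijective _ (nodeMk_bij n c)) fun p => ?_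
  simp only [Equiv.ofBijective_apply, nodeMk, size, sizeList]
  omega

lemma NS_eq' (n : ℕ) (c : Bool) :
    NS n c * (1 - (C (2 * n : ℝ) * X + NS n (!c))) = X * (C (2 * n : ℝ) * X + NS n (!c)) ^ 2 := by
  have h1 := NS_eq n c
  have h2 := gf_LT n c
  generalize gf (fun l : LT' n c => sizeList l.1) = L at *
  linear_combination (1 - (C (2 * n : ℝ) * X + NS n (!c))) * h1 +
    X * (C (2 * n : ℝ) * X + NS n (!c)) ^ 2 * h2

lemma NS_const (n : ℕ) (c : Bool) : constantCoeff (NS n c) = 0 := by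
  rw [NS_eq]; simp

lemma NS_symm (n : ℕ) : NS n false = NS n true := by
  have h1 := NS_eq' n true
  have h2 := NS_eq' n false
  simp only [Bool.not_true, Bool.not_false] at h1 h2
  have c1 := NS_const n true
  have c2 := NS_const n false
  generalize NS n true = a at *
  generalize NS n false = b at *
  generalize hu : C (2 * n : ℝ) * X = u at *
  have hu0 : constantCoeff u = 0 := by rw [← hu]; simp
  have key : (b - a) * ((1 - (u + a)) * (1 - (u + b)) +
      X * ((u + a) + (u + b) - (u + a) * (u + b))) = 0 := by
    linear_combination (1 - (u + b)) * h2 - (1 - (u + a)) * h1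
  rcases mul_eq_zero.1 key with h | h
  · exact sub_eq_zero.1 h
  · exfalso
    have := congrArg (constantCoeff (R := ℝ)) h
    simp [hu0, c1, c2] at this

end Combinatorics

section Skeleton
open PowerSeries

/-- The literal of a leaf. -/
def skel {n : ℕ} : AT n → Option (Fin n × Bool)
  | .leaf i b => some (i, b)
  | .node _ _ => none

/-- Root skeleton. -/
def sk {n : ℕ} (t : AT n) : List (Option (Fin n × Bool)) := (rootChildren t).map skel

lemma leafChildLabels_eq {n : ℕ} (t : AT n) : leafChildLabels t = (sk t).filterMap id := by
  unfold leafChildLabels sk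
  rw [List.filterMap_map]
  congr 1

/-- Lists of admissible children with a given skeleton. -/
abbrev SKT (n : ℕ) (c : Bool) (s : List (Option (Fin n × Bool))) : Type :=
  {l : LT' n c // l.1.map skel = s}

lemma FF_SKT (n : ℕ) (c : Bool) (s : List (Option (Fin n × Bool))) :
    FF (fun l : SKT n c s => sizeList l.1.1) :=
  (FF_LT n c).of_inj Subtype.val Subtype.val_injective fun _ => rfl

/-- The series attached to a skeleton. -/
noncomputable def skS {n : ℕ} (N : PowerSeries ℝ) : List (Option (Fin n × Bool)) → PowerSeries ℝ
  | [] => 1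
  | some _ :: s => X * skS N s
  | none :: s => N * skS N s

lemma gf_SKT (n : ℕ) (c : Bool) (s : List (Option (Fin n × Bool))) :
    gf (fun l : SKT n c s => sizeList l.1.1) = skS (NS n (!c)) s := by
  induction s with
  | nil =>
    rw [skS]
    ext m
    simp only [gf, coeff_mk, coeff_one]
    split_ifs with h
    · subst h
      have : Nat.card {y : SKT n c [] // sizeList y.1.1 = 0} = 1 := by
        rw [Nat.card_eq_one_iff_unique]
        refine ⟨⟨?_⟩, ⟨⟨⟨⟨[], by simp⟩, rfl⟩, by simp [sizeList]⟩⟩⟩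
        rintro ⟨⟨⟨l, h1⟩, h2⟩, h3⟩ ⟨⟨⟨l', h1'⟩, h2'⟩, h3'⟩
        simp only [List.map_eq_nil_iff] at h2 h2'
        subst h2 h2'
        rfl
      rw [this]; simp
    · have : IsEmpty {y : SKT n c [] // sizeList y.1.1 = m} := by
        refine ⟨?_⟩
        rintro ⟨⟨⟨l, h1⟩, h2⟩, h3⟩
        simp only [List.map_eq_nil_iff] at h2
        subst h2
        simp only [sizeList] at h3
        exact h h3.symm
      simp
  | cons a s ih =>
    cases a with
    | some x =>
      rw [skS, ← ih, ← gf_succ]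
      symm
      refine gf_congr (Equiv.ofBijective (fun l => (⟨⟨AT.leaf x.1 x.2 :: l.1.1, by
        intro t ht
        rcases List.mem_cons.1 ht with rfl | h
        · exact ⟨.leaf _ _, by simp [rootConn]⟩
        · exact l.1.2 t h⟩, by
          show skel _ :: l.1.1.map skel = _
          rw [l.2]; rfl⟩ : SKT n c (some x :: s))) ⟨?_, ?_⟩) ?_
      · rintro ⟨⟨l, h1⟩, h2⟩ ⟨⟨l', h1'⟩, h2'⟩ h
        have := congrArg (fun z => z.1.1) h
        simp only [List.cons.injEq, true_and] at this
        subst this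
        rfl
      · rintro ⟨⟨l, h1⟩, h2⟩
        match l, h1, h2 with
        | [], _, h2 => simp at h2
        | .node c' ts :: l, _, h2 => simp [skel] at h2
        | .leaf i b :: l, h1, h2 =>
          simp only [List.map_cons, skel, List.cons.injEq, Option.some.injEq] at h2
          obtain ⟨rfl, h3⟩ := h2
          exact ⟨⟨⟨l, fun t ht => h1 t (by simp [ht])⟩, h3⟩, rfl⟩
      · rintro ⟨⟨l, h1⟩, h2⟩
        show _ = sizeList (AT.leaf x.1 x.2 :: l)
        rw [sizeList, size, add_comm]
    | none =>
      rw [skS, ← ih, NS, ← gf_prod (FF_NT n _) (FF_SKT n c s)]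
      symm
      refine gf_congr (Equiv.ofBijective (fun p => (⟨⟨p.1.1 :: p.2.1.1, by
        intro t ht
        rcases List.mem_cons.1 ht with rfl | h
        · exact ⟨p.1.2.1, by rw [p.1.2.2]; simp⟩
        · exact p.2.1.2 t h⟩, by
          show skel _ :: p.2.1.1.map skel = _
          rw [p.2.2]
          congr 1
          obtain ⟨⟨t, h1, h2⟩, _⟩ := p
          cases t with
          | leaf i b => simp [rootConn] at h2
          | node c' ts => rfl⟩ : SKT n c (none :: s))) ⟨?_, ?_⟩) ?_
      · rintro ⟨⟨t, ht⟩, ⟨l, h1⟩, h2⟩ ⟨⟨t', ht'⟩, ⟨l', h1'⟩, h2'⟩ h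
        have := congrArg (fun z => z.1.1) h
        simp only [List.cons.injEq] at this
        obtain ⟨rfl, rfl⟩ := this
        rfl
      · rintro ⟨⟨l, h1⟩, h2⟩
        match l, h1, h2 with
        | [], _, h2 => simp at h2
        | .leaf i b :: l, _, h2 => simp [skel] at h2
        | .node c' ts :: l, h1, h2 =>
          simp only [List.map_cons, skel, List.cons.injEq, true_and] at h2
          have h3 := h1 (.node c' ts) (by simp)
          refine ⟨(⟨.node c' ts, h3.1, ?_⟩, ⟨⟨l, fun t ht => h1 t (by simp [ht])⟩, h2⟩), rfl⟩
          have h4 := h3.2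
          simp only [rootConn, ne_eq, Option.some.injEq] at h4 ⊢
          cases c <;> cases c' <;> simp_all
      · rintro ⟨t, ⟨l, h1⟩, h2⟩
        show _ = sizeList (t.1 :: l)
        rw [sizeList]

lemma gf_sk (n : ℕ) (s : List (Option (Fin n × Bool))) (hs : 2 ≤ s.length) :
    gf (fun t : {t : AT n // sk t = s ∧ WF t} => size t.1) = C 2 * (X * skS (NS n true) s) := by
  have h1 := gf_SKT n true s
  have h2 := gf_SKT n false s
  simp only [Bool.not_true, Bool.not_false, NS_symm] at h1 h2
  have h3 : C 2 * (X * skS (NS n true) s) = X * (gf (fun l : SKT n true s => sizeList l.1.1) +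
      gf (fun l : SKT n false s => sizeList l.1.1)) := by
    rw [h1, h2, show (C (2:ℝ)) = 2 from map_ofNat C 2]; ring
  rw [h3, ← gf_sum (FF_SKT _ _ _) (FF_SKT _ _ _), ← gf_succ]
  symm
  have mk : ∀ (c : Bool) (l : SKT n c s), sk (AT.node c l.1.1) = s ∧ WF (AT.node c l.1.1) := by
    rintro c ⟨⟨l, h1⟩, h2⟩
    refine ⟨h2, WF.node_iff.2 ⟨?_, h1⟩⟩
    have := congrArg List.length h2
    rw [List.length_map] at this
    show 2 ≤ l.length
    rw [this]; exact hs
  refine gf_congr (Equiv.ofBijective (Sum.elim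
    (fun l => (⟨AT.node true l.1.1, mk true l⟩ : {t : AT n // sk t = s ∧ WF t}))
    (fun l => ⟨AT.node false l.1.1, mk false l⟩)) ⟨?_, ?_⟩) ?_
  · rintro (⟨⟨l, h1⟩, h2⟩ | ⟨⟨l, h1⟩, h2⟩) (⟨⟨l', h1'⟩, h2'⟩ | ⟨⟨l', h1'⟩, h2'⟩) h <;>
    · have := congrArg Subtype.val h
      simp only [Sum.elim_inl, Sum.elim_inr, AT.node.injEq, Bool.true_eq_false,
        Bool.false_eq_true, false_and, true_and] at this
      try subst this
      try rfl
  · rintro ⟨t, h1, h2⟩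
    cases t with
    | leaf i b =>
      rw [← h1] at hs
      simp [sk, rootChildren] at hs
    | node c l =>
      have h4 := (WF.node_iff.1 h2).2
      cases c
      · exact ⟨Sum.inr ⟨⟨l, h4⟩, h1⟩, rfl⟩
      · exact ⟨Sum.inl ⟨⟨l, h4⟩, h1⟩, rfl⟩
  · rintro (⟨⟨l, h1⟩, h2⟩ | ⟨⟨l, h1⟩, h2⟩)
    · show sizeList l + 1 = size (AT.node true l)
      rw [size, add_comm]
    · show sizeList l + 1 = size (AT.node false l)
      rw [size, add_comm]

lemma gf_all (n : ℕ) :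
    gf (fun t : {t : AT n // WF t} => size t.1) = C (2 * n : ℝ) * X + C 2 * NS n true := by
  have h0 : C 2 * NS n true = NS n true + NS n false := by
    rw [NS_symm, show (C (2:ℝ)) = 2 from map_ofNat C 2]; ring
  have hb := gf_BT n true
  simp only [Bool.not_true] at hb
  rw [h0, show C (2 * n : ℝ) * X + (NS n true + NS n false) =
    (C (2 * n : ℝ) * X + NS n false) + NS n true by ring, ← hb, NS,
    ← gf_sum (FF_BT n _) (FF_NT n _)]
  symm
  refine gf_congr (Equiv.ofBijective (Sum.elim
    (fun t : BT n true => (⟨t.1, t.2.1⟩ : {t : AT n // WF t}))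
    (fun t : NT n true => ⟨t.1, t.2.1⟩)) ⟨?_, ?_⟩) ?_
  · rintro (⟨t, h1, h2⟩ | ⟨t, h1, h2⟩) (⟨t', h1', h2'⟩ | ⟨t', h1', h2'⟩) h <;>
    · have := congrArg Subtype.val h
      simp only [Sum.elim_inl, Sum.elim_inr] at this
      subst this
      first
      | rfl
      | contradiction
  · rintro ⟨t, h1⟩
    by_cases h2 : rootConn t = some true
    · exact ⟨Sum.inr ⟨t, h1, h2⟩, rfl⟩
    · exact ⟨Sum.inl ⟨t, h1, h2⟩, rfl⟩
  · rintro (t | t) <;> rfl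

end Skeleton

section Limit
open PowerSeries Filter Topology

/-- Value weight of a skeleton. -/
noncomputable def pf {L : Type} (r v : ℝ) : List (Option L) → ℝ
  | [] => 1
  | some _ :: s => r * pf r v s
  | none :: s => v * pf r v s

/-- Derivative weight of a skeleton. -/
noncomputable def pd {L : Type} (r v : ℝ) : List (Option L) → ℝ
  | [] => 0
  | some _ :: s => r * pd r v s
  | none :: s => v * pd r v s + pf r v s

lemma pf_nonneg {L : Type} {r v : ℝ} (hr : 0 ≤ r) (hv : 0 ≤ v) (s : List (Option L)) :
    0 ≤ pf r v s := by
  induction s with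
  | nil => simp [pf]
  | cons a s ih => cases a <;> rw [pf] <;> positivity

lemma pd_nonneg {L : Type} {r v : ℝ} (hr : 0 ≤ r) (hv : 0 ≤ v) (s : List (Option L)) :
    0 ≤ pd r v s := by
  induction s with
  | nil => simp [pd]
  | cons a s ih =>
    have := pf_nonneg hr hv s
    cases a <;> rw [pd] <;> positivity

lemma skS_tame {n : ℕ} {r d : ℝ} {N : PowerSeries ℝ} (h : Tame (rescale r N) d)
    (s : List (Option (Fin n × Bool))) :
    Tame (rescale r (skS N s)) (pd r (ev (rescale r N)) s * d) ∧
      ev (rescale r (skS N s)) = pf r (ev (rescale r N)) s := by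
  induction s with
  | nil =>
    have h1 := tame_C 1
    have h2 := ev_C 1
    rw [map_one] at h1 h2
    simpa [skS, pd, pf] using ⟨h1, h2⟩
  | cons a s ih =>
    cases a with
    | some x =>
      simp only [skS, map_mul, rescale_X, pd, pf]
      have h1 := tame_X.smul r
      have e1 := tame_X.ev_smul r
      rw [ev_X] at e1
      constructor
      · convert h1.mul ih.1 using 1
        rw [e1]; ring
      · rw [h1.ev_mul ih.1, e1, ih.2, mul_one]
    | none =>
      simp only [skS, map_mul, pd, pf]
      constructor
      · convert h.mul ih.1 using 1
        rw [ih.2]; ring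
      · rw [h.ev_mul ih.1, ih.2]

open Classical in
/-- Lists of given length. -/
noncomputable def lls (α : Type) [Fintype α] : ℕ → Finset (List α)
  | 0 => {[]}
  | k + 1 => ((Finset.univ : Finset α) ×ˢ lls α k).image (fun p => p.1 :: p.2)

lemma mem_lls {α : Type} [Fintype α] (k : ℕ) (l : List α) : l ∈ lls α k ↔ l.length = k := by
  induction k generalizing l with
  | zero => simp [lls]
  | succ k ih =>
    cases l with
    | nil => simp [lls]
    | cons a l => simp [lls, ih]

lemma sum_lls_succ {α : Type} [Fintype α] (k : ℕ) (f : List α → ℝ) :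
    ∑ l ∈ lls α (k + 1), f l = ∑ a : α, ∑ l ∈ lls α k, f (a :: l) := by
  classical
  rw [lls, Finset.sum_image, Finset.sum_product]
  rintro ⟨a, l⟩ _ ⟨a', l'⟩ _ h
  simpa using h

lemma lls_disj {α : Type} [Fintype α] (S : Set ℕ) (f : ℕ → ℕ) (hf : Function.Injective f) :
    S.PairwiseDisjoint (fun i => lls α (f i)) := by
  intro i _ j _ hij
  rw [Function.onFun, Finset.disjoint_left]
  intro l h1 h2
  rw [mem_lls] at h1 h2
  exact hij (hf (h1.symm.trans h2))

lemma sum_pf {n : ℕ} (r v : ℝ) (k : ℕ) :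
    ∑ l ∈ lls (Option (Fin n × Bool)) k, pf r v l = (2 * n * r + v) ^ k := by
  induction k with
  | zero => simp [lls, pf]
  | succ k ih =>
    rw [sum_lls_succ, Fintype.sum_option]
    simp only [pf, ← Finset.mul_sum, ih, Finset.sum_const, Finset.card_univ, Fintype.card_prod,
      Fintype.card_fin, Fintype.card_bool, nsmul_eq_mul]
    push_cast; ring

lemma sum_pd {n : ℕ} (r v : ℝ) (k : ℕ) :
    ∑ l ∈ lls (Option (Fin n × Bool)) k, pd r v l = k * (2 * n * r + v) ^ (k - 1) := by
  induction k with
  | zero => simp [lls, pd]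
  | succ k ih =>
    rw [sum_lls_succ, Fintype.sum_option]
    simp only [pd, Finset.sum_add_distrib, ← Finset.mul_sum, ih, sum_pf, Finset.sum_const,
      Finset.card_univ, Fintype.card_prod,
      Fintype.card_fin, Fintype.card_bool, nsmul_eq_mul]
    cases k with
    | zero => simp
    | succ k => simp only [Nat.add_sub_cancel]; push_cast; ring

/-- The limiting probability of a skeleton. -/
noncomputable def pp {L : Type} (r v : ℝ) (s : List (Option L)) : ℝ :=
  if 2 ≤ s.length then r * pd r v s else 0

lemma pp_nonneg {L : Type} {r v : ℝ} (hr : 0 ≤ r) (hv : 0 ≤ v) (s : List (Option L)) :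
    0 ≤ pp r v s := by
  unfold pp
  have := pd_nonneg hr hv s
  split_ifs <;> positivity

lemma pp_total {n : ℕ} {r v : ℝ} (hr : 0 ≤ r) (hv : 0 ≤ v) (h1 : 2 * n * r + v < 1)
    (h2 : r = (1 + r) * (1 - (2 * n * r + v)) ^ 2) (a : ℝ) (ha : a < 1) :
    ∃ K : Finset (List (Option (Fin n × Bool))), a < ∑ s ∈ K, pp r v s := by
  set q := 2 * n * r + v with hq
  have hq0 : 0 ≤ q := by positivity
  have hqn : ‖q‖ < 1 := by rwa [Real.norm_of_nonneg hq0]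
  have e1 := (hasSum_coe_mul_geometric_of_norm_lt_one hqn).mul_left q
  have e2 := (hasSum_geometric_of_norm_lt_one hqn).mul_left (2 * q)
  have e3 := (e1.add e2).mul_left r
  have hne : 1 - q ≠ 0 := by linarith
  have e4 : r * (q * (q / (1 - q) ^ 2) + 2 * q * (1 - q)⁻¹) = 1 := by
    field_simp
    linear_combination h2
  rw [e4] at e3
  have e5 := e3.tendsto_sum_nat
  obtain ⟨k, hk⟩ := (e5.eventually (lt_mem_nhds ha)).exists
  refine ⟨(Finset.range k).biUnion fun i => lls (Option (Fin n × Bool)) (i + 2), ?_⟩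
  rw [Finset.sum_biUnion (lls_disj _ (fun i => i + 2) (add_left_injective 2))]
  refine hk.trans_le (le_of_eq ?_)
  refine Finset.sum_congr rfl fun i _ => ?_
  have : ∑ s ∈ lls (Option (Fin n × Bool)) (i + 2), pp r v s =
      ∑ s ∈ lls (Option (Fin n × Bool)) (i + 2), r * pd r v s := by
    refine Finset.sum_congr rfl fun s hs => ?_
    rw [mem_lls] at hs
    rw [pp, if_pos (by omega)]
  rw [this, ← Finset.mul_sum, sum_pd, ← hq]
  simp only [show i + 2 - 1 = i + 1 by omega]
  push_cast; ring

lemma pratt {I : Type} (Q : ℕ → Set I → ℝ) (p : I → ℝ) (hp : ∀ i, 0 ≤ p i)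
    (h1 : ∀ m (S : Set I) (K : Finset I), (∀ i ∈ K, i ∈ S) → ∑ i ∈ K, Q m {i} ≤ Q m S)
    (h2 : ∀ m S, Q m S + Q m Sᶜ ≤ 1)
    (h3 : ∀ i, Tendsto (fun m => Q m {i}) atTop (𝓝 (p i)))
    (h4 : ∀ a < 1, ∃ K : Finset I, a < ∑ i ∈ K, p i) (S : Set I) :
    Tendsto (fun m => Q m S) atTop (𝓝 (∑' i, S.indicator p i)) := by
  classical
  have hlim : ∀ K : Finset I, Tendsto (fun m => ∑ i ∈ K, Q m {i}) atTop (𝓝 (∑ i ∈ K, p i)) :=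
    fun K => tendsto_finsetSum _ fun i _ => h3 i
  have hle : ∀ K : Finset I, ∑ i ∈ K, p i ≤ 1 := by
    intro K
    refine le_of_tendsto' (hlim K) fun m => ?_
    have e1 := h1 m Set.univ K (fun i _ => Set.mem_univ i)
    have e2 := h2 m Set.univ
    have e3 := h1 m (Set.univ)ᶜ ∅ (by simp)
    simp only [Finset.sum_empty] at e3
    linarith
  have hsum : Summable p := summable_of_sum_le hp hle
  have htot : ∑' i, p i = 1 := by
    apply le_antisymm
    · exact hsum.tsum_le_of_sum_le hle
    · by_contra! hlt
      obtain ⟨K, hK⟩ := h4 _ hlt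
      exact absurd (hsum.sum_le_tsum K fun i _ => hp i) (not_le.2 hK)
  have lower : ∀ (S : Set I) (a : ℝ), a < ∑' i, S.indicator p i → ∀ᶠ m in atTop, a < Q m S := by
    intro S a ha
    have hs := hsum.indicator S
    obtain ⟨K, hK⟩ := (hs.hasSum.eventually (lt_mem_nhds ha)).exists
    have e : ∑ i ∈ K, S.indicator p i = ∑ i ∈ K.filter (· ∈ S), p i := by
      rw [Finset.sum_filter]
      exact Finset.sum_congr rfl fun i _ => by rw [Set.indicator_apply]
    rw [e] at hK
    filter_upwards [(hlim (K.filter (· ∈ S))).eventually (lt_mem_nhds hK)] with m hm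
    exact hm.trans_le (h1 m S _ fun i hi => (Finset.mem_filter.1 hi).2)
  have hcompl : ∑' i, Sᶜ.indicator p i = 1 - ∑' i, S.indicator p i := by
    have := (hsum.indicator S).tsum_add (hsum.indicator Sᶜ)
    have e : (fun i => S.indicator p i + Sᶜ.indicator p i) = p := by
      funext i
      exact congrFun (Set.indicator_self_add_compl S p) i
    rw [e] at this
    linarith
  rw [tendsto_order]
  refine ⟨lower S, fun b hb => ?_⟩
  filter_upwards [lower Sᶜ (1 - b) (by rw [hcompl]; linarith)] with m hm
  have := h2 m S
  linarith

end Limit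

section Bound
open Filter Topology

/-- Literals of a skeleton. -/
def lits {n : ℕ} (l : List (Option (Fin n × Bool))) : Finset (Fin n × Bool) :=
  (l.filterMap id).toFinset

lemma lits_none {n : ℕ} (l : List (Option (Fin n × Bool))) : lits (none :: l) = lits l := by
  simp [lits]

lemma lits_some {n : ℕ} (x : Fin n × Bool) (l : List (Option (Fin n × Bool))) :
    lits (some x :: l) = insert x (lits l) := by
  simp [lits]

/-- Truncated sum over lists of length less than `k` with at most `s` literals from state `D`. -/
noncomputable def PS {n : ℕ} (f : List (Option (Fin n × Bool)) → ℝ) (s k : ℕ)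
    (D : Finset (Fin n × Bool)) : ℝ :=
  ∑ i ∈ Finset.range k, ∑ l ∈ lls (Option (Fin n × Bool)) i,
    if (D ∪ lits l).card ≤ s then f l else 0

lemma PS_big {n : ℕ} (f : List (Option (Fin n × Bool)) → ℝ) (s k : ℕ)
    (D : Finset (Fin n × Bool)) (h : s < D.card) : PS f s k D = 0 := by
  unfold PS
  refine Finset.sum_eq_zero fun i _ => Finset.sum_eq_zero fun l _ => if_neg ?_
  have := Finset.card_le_card (Finset.subset_union_left (s₁ := D) (s₂ := lits l))
  omega

lemma PS_succ {n : ℕ} (f : List (Option (Fin n × Bool)) → ℝ) (s k : ℕ)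
    (D : Finset (Fin n × Bool)) (h : D.card ≤ s) :
    PS f s (k + 1) D = f [] + PS (fun l => f (none :: l)) s k D +
      ∑ x : Fin n × Bool, PS (fun l => f (some x :: l)) s k (insert x D) := by
  unfold PS
  rw [Finset.sum_range_succ']
  have h0 : (∑ l ∈ lls (Option (Fin n × Bool)) 0, if (D ∪ lits l).card ≤ s then f l else 0)
      = f [] := by
    simp [lls, lits, h]
  rw [h0, add_comm, add_assoc]
  congr 1
  rw [Finset.sum_comm, ← Finset.sum_add_distrib]
  refine Finset.sum_congr rfl fun i _ => ?_
  rw [sum_lls_succ, Fintype.sum_option]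
  simp only [lits_none, lits_some, Finset.union_insert, Finset.insert_union]

lemma sum_insert_card {n : ℕ} (D : Finset (Fin n × Bool)) (g : ℕ → ℝ) :
    ∑ x : Fin n × Bool, g (insert x D).card =
      (D.card : ℝ) * g D.card + (2 * (n : ℝ) - (D.card : ℝ)) * g (D.card + 1) := by
  have hc : ((Dᶜ).card : ℝ) = 2 * n - D.card := by
    rw [Finset.card_compl, Nat.cast_sub (Finset.card_le_univ D)]
    simp [Fintype.card_prod]; ring
  rw [← Finset.sum_add_sum_compl D, ← hc]
  congr 1
  · have : ∑ x ∈ D, g (insert x D).card = ∑ x ∈ D, g D.card :=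
      Finset.sum_congr rfl fun x hx => by rw [Finset.insert_eq_of_mem hx]
    rw [this]; simp
  · have : ∑ x ∈ Dᶜ, g (insert x D).card = ∑ x ∈ Dᶜ, g (D.card + 1) :=
      Finset.sum_congr rfl fun x hx => by
        rw [Finset.card_insert_of_notMem (Finset.mem_compl.1 hx)]
    rw [this]; simp

lemma PS_mul {n : ℕ} (f : List (Option (Fin n × Bool)) → ℝ) (s k : ℕ)
    (D : Finset (Fin n × Bool)) (a : ℝ) : PS (fun l => a * f l) s k D = a * PS f s k D := by
  unfold PS
  simp only [Finset.mul_sum, mul_ite, mul_zero]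

lemma PS_add {n : ℕ} (f g : List (Option (Fin n × Bool)) → ℝ) (s k : ℕ)
    (D : Finset (Fin n × Bool)) : PS (fun l => f l + g l) s k D = PS f s k D + PS g s k D := by
  unfold PS
  simp only [← Finset.sum_add_distrib]
  refine Finset.sum_congr rfl fun i _ => Finset.sum_congr rfl fun l _ => ?_
  split_ifs <;> simp

lemma PS_bound {n s : ℕ} (hs : s ≤ n) {r v : ℝ} (hr : 0 ≤ r) (hv : 0 ≤ v)
    (h1 : 2 * n * r + v ≤ 1) (h5 : 1 ≤ 5 * n * r) (k : ℕ) (D : Finset (Fin n × Bool)) :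
    PS (pf r v) s k D ≤ 5 * ((s + 1 - D.card : ℕ) : ℝ) ∧
    PS (pd r v) s k D ≤ 25 * ((s + 1 - D.card : ℕ) : ℝ) ^ 2 := by
  induction k generalizing D with
  | zero =>
    simp only [PS, Finset.range_zero, Finset.sum_empty]
    constructor <;> positivity
  | succ k ih =>
    by_cases hD : D.card ≤ s
    · rw [PS_succ _ _ _ _ hD, PS_succ _ _ _ _ hD]
      simp only [pf, pd, PS_add, PS_mul]
      rw [← Finset.mul_sum, ← Finset.mul_sum]
      have s1 := (Finset.sum_le_sum fun x (_ : x ∈ Finset.univ) => (ih (insert x D)).1).trans_eq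
        (sum_insert_card D fun c => 5 * ((s + 1 - c : ℕ) : ℝ))
      have s2 := (Finset.sum_le_sum fun x (_ : x ∈ Finset.univ) => (ih (insert x D)).2).trans_eq
        (sum_insert_card D fun c => 25 * ((s + 1 - c : ℕ) : ℝ) ^ 2)
      obtain ⟨i1, i2⟩ := ih D
      have e1 : ((s + 1 - D.card : ℕ) : ℝ) = s + 1 - D.card := by
        rw [Nat.cast_sub (by omega)]; push_cast; ring
      have e2 : ((s + 1 - (D.card + 1) : ℕ) : ℝ) = s - D.card := by
        rw [Nat.cast_sub (by omega)]; push_cast; ring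
      rw [e1, e2] at s1 s2
      rw [e1] at i1 i2 ⊢
      have hd1 : (D.card : ℝ) ≤ s := by exact_mod_cast hD
      have hd2 : (s : ℝ) ≤ n := by exact_mod_cast hs
      have hd0 : (0:ℝ) ≤ D.card := by positivity
      generalize (D.card : ℝ) = d at *
      have hw : 1 ≤ 5 * (r * (2 * n - d)) := by nlinarith
      have s1' := mul_le_mul_of_nonneg_left s1 hr
      have s2' := mul_le_mul_of_nonneg_left s2 hr
      have i1' := mul_le_mul_of_nonneg_left i1 hv
      have i2' := mul_le_mul_of_nonneg_left i2 hv
      obtain ⟨e, he⟩ : ∃ e : ℝ, e = s + 1 - d := ⟨_, rfl⟩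
      have he1 : 1 ≤ e := by linarith
      have he2 : (s:ℝ) - d = e - 1 := by linarith
      rw [← he, he2] at s1' s2'
      rw [← he] at i1 i1' i2 i2' ⊢
      have k1 : (2 * n * r + v) * (5 * e) ≤ 1 * (5 * e) :=
        mul_le_mul_of_nonneg_right h1 (by linarith)
      have k2 : (2 * n * r + v) * (25 * e ^ 2) ≤ 1 * (25 * e ^ 2) :=
        mul_le_mul_of_nonneg_right h1 (by positivity)
      have k3 : 1 * (5 * (2 * e - 1)) ≤ 5 * (r * (2 * n - d)) * (5 * (2 * e - 1)) :=
        mul_le_mul_of_nonneg_right hw (by linarith)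
      constructor
      · linarith
      · linarith
    · rw [PS_big _ _ _ _ (by omega), PS_big _ _ _ _ (by omega)]
      constructor <;> positivity

/-- The skeletons of `Gfam`. -/
def Gsk (n : ℕ) : Set (List (Option (Fin n × Bool))) :=
  {s | s.filterMap id ≠ [] ∧ (∀ l ∈ lits s, (l.1, !l.2) ∉ lits s) ∧
    ((lits s).card : ℝ) < (n : ℝ) ^ ((1 : ℝ) / 4)}

lemma Gfam_eq (n : ℕ) : Gfam n = {t | sk t ∈ Gsk n} := by
  ext t
  simp only [Gfam, Gsk, lits, leafChildLabels_eq]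
  rfl

/-- The limit value. -/
noncomputable def muG (n : ℕ) : ℝ :=
  if n = 0 then 0 else ∑' s, (Gsk n).indicator
    (pp (rho n) (ev (PowerSeries.rescale (rho n) (NS n true)))) s

lemma ev_NS_nonneg (n : ℕ) (hn : 1 ≤ n) : 0 ≤ ev (PowerSeries.rescale (rho n) (NS n true)) := by
  refine tsum_nonneg fun m => ?_
  rw [PowerSeries.coeff_rescale]
  have := rho_pos hn
  simp only [NS, gf, PowerSeries.coeff_mk]
  positivity

lemma NS_analytic (n : ℕ) (hn : 1 ≤ n) :
    ∃ d, d ≠ 0 ∧ Tame (PowerSeries.rescale (rho n) (NS n true)) d ∧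
      2 * n * rho n + ev (PowerSeries.rescale (rho n) (NS n true)) < 1 ∧
      rho n = (1 + rho n) *
        (1 - (2 * n * rho n + ev (PowerSeries.rescale (rho n) (NS n true)))) ^ 2 :=
  main_analytic hn (NS n true) (NS_const n true) (by
    have := NS_eq' n true
    simpa only [Bool.not_true, NS_symm] using this)

lemma muG_bound (n : ℕ) (hn : 1 ≤ n) : 0 ≤ muG n ∧ muG n ≤ 113 * (1 / Real.sqrt n) := by
  obtain ⟨d, hd, ht, h1, h2⟩ := NS_analytic n hn
  have hr := rho_pos hn
  have hv := ev_NS_nonneg n hn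
  rw [muG, if_neg (by omega)]
  set r := rho n
  set v := ev (PowerSeries.rescale r (NS n true))
  have hpp : ∀ s, 0 ≤ (Gsk n).indicator (pp r v) s := fun s =>
    Set.indicator_nonneg (fun s _ => pp_nonneg hr.le hv s) s
  refine ⟨tsum_nonneg hpp, ?_⟩
  have hn1 : (1:ℝ) ≤ n := by exact_mod_cast hn
  set w : ℝ := (n : ℝ) ^ ((1 : ℝ) / 4) with hw
  have hw1 : 1 ≤ w := Real.one_le_rpow hn1 (by norm_num)
  have hwn : w ≤ n := by
    calc w ≤ (n:ℝ) ^ (1:ℝ) := Real.rpow_le_rpow_of_exponent_le hn1 (by norm_num)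
      _ = n := Real.rpow_one _
  have hwsq : w ^ 2 = Real.sqrt n := by
    rw [hw, Real.sqrt_eq_rpow, ← Real.rpow_natCast, ← Real.rpow_mul (by positivity)]
    norm_num
  set s := ⌈w⌉₊ with hs
  have hsn : s ≤ n := Nat.ceil_le.2 hwn
  have hsw : (s:ℝ) < w + 1 := Nat.ceil_lt_add_one (by linarith)
  have hb : ∀ K : Finset (List (Option (Fin n × Bool))),
      ∑ l ∈ K, (Gsk n).indicator (pp r v) l ≤ r * (25 * (s + 1) ^ 2) := by
    intro K
    have hB := (PS_bound hsn hr.le hv h1.le (five_n_rho hn) (K.sup List.length + 1) ∅).2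
    simp only [Finset.card_empty, Nat.sub_zero] at hB
    push_cast at hB
    refine le_trans ?_ (mul_le_mul_of_nonneg_left hB hr.le)
    unfold PS
    rw [← Finset.sum_biUnion (lls_disj _ (fun i => i) (fun _ _ h => h)), Finset.mul_sum]
    refine (Finset.sum_le_sum_of_subset_of_nonneg (t := (Finset.range (K.sup List.length + 1)).biUnion
      fun i => lls (Option (Fin n × Bool)) i) ?_ fun l _ _ => hpp l).trans
      (Finset.sum_le_sum fun l _ => ?_)
    · intro l hl
      rw [Finset.mem_biUnion]
      refine ⟨l.length, ?_, (mem_lls _ _).2 rfl⟩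
      have := Finset.le_sup (f := List.length) hl
      rw [Finset.mem_range]; omega
    · have hpd := pd_nonneg hr.le hv l
      by_cases hl : l ∈ Gsk n
      · rw [Set.indicator_of_mem hl, if_pos]
        · unfold pp
          split_ifs
          · exact le_rfl
          · positivity
        · rw [Finset.empty_union]
          have h6 : ((lits l).card : ℝ) < w := hl.2.2
          have : ((lits l).card : ℝ) ≤ s := h6.le.trans (Nat.le_ceil w)
          exact_mod_cast this
      · rw [Set.indicator_of_notMem hl]
        split_ifs <;> positivity
  have hb2 : ∑' l, (Gsk n).indicator (pp r v) l ≤ r * (25 * (s + 1) ^ 2) :=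
    (summable_of_sum_le hpp hb).tsum_le_of_sum_le hb
  refine hb2.trans ?_
  have h7 : (s + 1 : ℝ) ^ 2 ≤ 9 * Real.sqrt n := by
    rw [← hwsq]
    nlinarith [(Nat.cast_nonneg s : (0:ℝ) ≤ s)]
  have h8 := two_n_rho hn
  have hsq : 0 < Real.sqrt n := Real.sqrt_pos.2 (by linarith)
  have hss : Real.sqrt n * Real.sqrt n = n := Real.mul_self_sqrt (by positivity)
  rw [mul_one_div, le_div_iff₀ hsq]
  calc r * (25 * (s + 1) ^ 2) * Real.sqrt n ≤ r * (25 * (9 * Real.sqrt n)) * Real.sqrt n := by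
        gcongr
    _ = 225 / 2 * (2 * n * r) := by linear_combination 225 * r * hss
    _ ≤ 113 := by
      have : 2 * n * r < 1 := h8
      linarith

lemma coeff_gf_subtype {n : ℕ} (P : AT n → Prop) (m : ℕ) :
    PowerSeries.coeff m (gf (fun t : {t : AT n // P t} => size t.1)) =
      (Nat.card {t : AT n // P t ∧ size t = m} : ℝ) := by
  simp only [gf, PowerSeries.coeff_mk]
  congr 1
  exact Nat.card_congr (Equiv.subtypeSubtypeEquivSubtypeInter P (fun t => size t = m))

open Classical in
lemma countIn_fin (n m : ℕ) : ∃ F : Finset (AT n), ∀ S : Set (List (Option (Fin n × Bool))),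
    countIn n {t | sk t ∈ S} m = (F.filter (fun t => sk t ∈ S)).card := by
  have hfin : {t : AT n | WF t ∧ size t = m}.Finite :=
    (finite_size_le n m).subset fun t ht => ht.2.le
  refine ⟨hfin.toFinset, fun S => ?_⟩
  refine Nat.subtype_card _ fun t => ?_
  simp only [Finset.mem_filter, Set.Finite.mem_toFinset]
  exact and_comm

lemma skel_limit (n : ℕ) (hn : 1 ≤ n) (s : List (Option (Fin n × Bool))) :
    Tendsto (fun m => (countIn n {t | sk t ∈ ({s} : Set _)} m : ℝ) / (A n m : ℝ)) atTop
      (𝓝 (pp (rho n) (ev (PowerSeries.rescale (rho n) (NS n true))) s)) := by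
  by_cases hs : 2 ≤ s.length
  · obtain ⟨d, hd, ht, -, -⟩ := NS_analytic n hn
    have hr := rho_pos hn
    set r := rho n
    set v := ev (PowerSeries.rescale r (NS n true))
    have h1 := skS_tame ht s
    have h2 := (tame_X.smul r).mul h1.1
    rw [tame_X.ev_smul, ev_X] at h2
    have h3 := Tendsto.div h2 ht hd
    have e : (r * 1 * (pd r v s * d) +
        ev ((PowerSeries.rescale r) (skS (NS n true) s)) * (r * 0)) / d = pp r v s := by
      rw [pp, if_pos hs]; field_simp; ring
    rw [e] at h3
    refine h3.congr' ?_
    filter_upwards [eventually_ge_atTop 2] with m hm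
    have hw := (wt_pos m).ne'
    have hrm : r ^ m ≠ 0 := by positivity
    have c1 : (countIn n {t | sk t ∈ ({s} : Set _)} m : ℝ) =
        2 * PowerSeries.coeff m (PowerSeries.X * skS (NS n true) s) := by
      rw [← PowerSeries.coeff_C_mul, ← gf_sk n s hs, coeff_gf_subtype]
      congr 1
      refine Nat.card_congr (Equiv.subtypeEquivRight fun t => ?_)
      rw [and_assoc]; rfl
    have c2 : (A n m : ℝ) = 2 * PowerSeries.coeff m (NS n true) := by
      have := congrArg (PowerSeries.coeff m) (gf_all n)
      rw [coeff_gf_subtype, map_add, PowerSeries.coeff_C_mul, PowerSeries.coeff_C_mul,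
        PowerSeries.coeff_X, if_neg (by omega), mul_zero, zero_add] at this
      rw [← this]
      congr 1
      refine Nat.card_congr (Equiv.subtypeEquivRight fun t => ?_)
      simp
    have c3 : PowerSeries.C r * PowerSeries.X * PowerSeries.rescale r (skS (NS n true) s) =
        PowerSeries.rescale r (PowerSeries.X * skS (NS n true) s) := by
      rw [map_mul, PowerSeries.rescale_X]
    simp only [Pi.div_apply]
    rw [c1, c2, c3, PowerSeries.coeff_rescale, PowerSeries.coeff_rescale,
      mul_div_mul_right _ _ hw, mul_div_mul_left _ _ hrm, mul_div_mul_left _ _ two_ne_zero]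
  · rw [pp, if_neg hs]
    refine tendsto_const_nhds.congr' ?_
    filter_upwards [eventually_ge_atTop 2] with m hm
    have : IsEmpty {t : AT n // t ∈ {t | sk t ∈ ({s} : Set _)} ∧ WF t ∧ size t = m} := by
      refine ⟨?_⟩
      rintro ⟨t, h1, h2, h3⟩
      cases t with
      | leaf i b =>
        rw [size] at h3; omega
      | node c ts =>
        have h4 := (WF.node_iff.1 h2).1
        have h5 : ts.map skel = s := h1
        rw [← h5, List.length_map] at hs
        exact hs h4
    rw [countIn, Nat.card_of_isEmpty]
    simp

lemma muG_lim (n : ℕ) : HasLimRatio n (Gfam n) (muG n) := by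
  classical
  rcases Nat.eq_zero_or_pos n with rfl | hn
  · rw [muG, if_pos rfl]
    refine tendsto_const_nhds.congr fun m => ?_
    have : IsEmpty {t : AT 0 // t ∈ Gfam 0 ∧ WF t ∧ size t = m} := by
      refine ⟨?_⟩
      rintro ⟨t, h1, h2, h3⟩
      obtain ⟨x, hx⟩ := List.exists_mem_of_ne_nil _ h1.1
      exact x.1.elim0
    rw [ratio, countIn, Nat.card_of_isEmpty]
    simp
  · rw [muG, if_neg (by omega), Gfam_eq]
    obtain ⟨d, hd, ht, h1, h2⟩ := NS_analytic n hn
    have hr := rho_pos hn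
    have hv := ev_NS_nonneg n hn
    refine pratt (fun m S => (countIn n {t | sk t ∈ S} m : ℝ) / (A n m : ℝ)) _
      (pp_nonneg hr.le hv) ?_ ?_ (skel_limit n hn) (pp_total hr.le hv h1 h2) (Gsk n)
    · intro m S K hK
      obtain ⟨F, hF⟩ := countIn_fin n m
      rw [← Finset.sum_div]
      refine div_le_div_of_nonneg_right ?_ (Nat.cast_nonneg _)
      simp only [hF]
      rw [← Nat.cast_sum, Nat.cast_le]
      have := Finset.card_eq_sum_card_fiberwise (f := sk) (s := F.filter (fun t => sk t ∈ K))
        (t := K) (fun t ht => (Finset.mem_filter.1 ht).2)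
      calc _ = (F.filter (fun t => sk t ∈ K)).card := by
            rw [this]
            refine Finset.sum_congr rfl fun i hi => ?_
            congr 1
            ext t
            simp only [Finset.mem_filter, Set.mem_singleton_iff]
            constructor
            · rintro ⟨a, rfl⟩; exact ⟨⟨a, hi⟩, rfl⟩
            · rintro ⟨⟨a, _⟩, b⟩; exact ⟨a, b⟩
        _ ≤ _ := Finset.card_le_card fun t ht => by
            simp only [Finset.mem_filter] at ht ⊢
            exact ⟨ht.1, hK _ ht.2⟩
    · intro m S
      obtain ⟨F, hF⟩ := countIn_fin n m
      have hA : A n m = F.card := by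
        have := hF Set.univ
        simp only [Set.mem_univ, Finset.filter_true] at this
        rw [← this]
        exact Nat.card_congr (Equiv.subtypeEquivRight fun t => by simp)
      rw [← add_div, hA]
      refine div_le_one_of_le₀ ?_ (Nat.cast_nonneg _)
      simp only [hF]
      rw [← Nat.cast_add, Nat.cast_le]
      have := Finset.card_filter_add_card_filter_not (s := F) (fun t => sk t ∈ S)
      simp only [Set.mem_compl_iff]
      convert this.le

end Bound

open Filter in
/-- The limiting ratio of `𝒢_n` is `O(1/√n)` as `n → ∞`. -/
theorem statement10 :
    ∃ μ : ℕ → ℝ, (∀ n : ℕ, HasLimRatio n (Gfam n) (μ n)) ∧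
      μ =O[atTop] (fun n : ℕ => 1 / Real.sqrt (n : ℝ)) := by

  refine ⟨muG, muG_lim, ?_⟩
  refine Asymptotics.IsBigO.of_bound 113 ?_
  filter_upwards [eventually_ge_atTop 1] with n hn
  obtain ⟨h1, h2⟩ := muG_bound n hn
  rw [Real.norm_of_nonneg h1, Real.norm_of_nonneg (by positivity)]
  exact h2
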